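/- Let d and q satisfy d ≡ 3 (mod 4) and q ≡ 3 (mod 4), with d ≥ 3. Then for every set A ⊆ F_q^d, one has (as an inequality of real numbers) SQ(A) + ZR(A) ≤ |A|²/2 + |A|²/(2q) − |A|²/(2q^{(d−1)/2}) − |A|²/(2q^{(d+1)/2}) + q^{(d−1)/2}·|A|. -/

import Mathlib

open Finset

/-- `‖x‖ = x₁² + ⋯ + x_d²` for `x ∈ F_q^d`. -/
def normSq {d : ℕ} {F : Type} [Field F] [Fintype F] (x : Fin d → F) : F := ∑ i, x i ^ 2

/-- `SQ(A)` : the number of pairs `(x,y) ∈ A×A` with `η(‖x−y‖) = 1`,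
where `η` is the quadratic character of `F` (with `η(0) = 0`). -/
noncomputable def SQpairs {d : ℕ} {F : Type} [Field F] [Fintype F] [DecidableEq F]
    (A : Finset (Fin d → F)) : ℕ :=
  ((A ×ˢ A).filter (fun p => quadraticChar F (normSq (p.1 - p.2)) = 1)).card

/-- `ZR(A)` : the number of pairs `(x,y) ∈ A×A` with `‖x−y‖ = 0`. -/
def ZRpairs {d : ℕ} {F : Type} [Field F] [Fintype F] [DecidableEq F]
    (A : Finset (Fin d → F)) : ℕ :=
  ((A ×ˢ A).filter (fun p => normSq (p.1 - p.2) = 0)).card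

section QuadraticGaussSums

variable {F : Type} [Field F] [Fintype F] [DecidableEq F]

/-- The quadratic character of a finite field with values in `ℂ`. -/
noncomputable def complexQuadraticChar (F : Type) [Field F] [Fintype F] [DecidableEq F] :
    MulChar F ℂ :=
  (quadraticChar F).ringHomComp (Int.castRingHom ℂ)

lemma complexQuadraticChar_apply (a : F) :
    complexQuadraticChar F a = ((quadraticChar F a : ℤ) : ℂ) := rfl

@[simp]
lemma complexQuadraticChar_zero : complexQuadraticChar F 0 = 0 := MulChar.map_zero _

lemma complexQuadraticChar_sq {a : F} (ha : a ≠ 0) : complexQuadraticChar F a ^ 2 = 1 := by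
  rw [complexQuadraticChar_apply]
  exact_mod_cast quadraticChar_sq_one ha

lemma complexQuadraticChar_inv (a : F) :
    complexQuadraticChar F a⁻¹ = complexQuadraticChar F a := by
  by_cases ha : a = 0
  · simp [ha]
  · have h₁ : complexQuadraticChar F a⁻¹ * complexQuadraticChar F a = 1 := by
      rw [← map_mul, inv_mul_cancel₀ ha, map_one]
    have h₂ := complexQuadraticChar_sq ha
    linear_combination complexQuadraticChar F a * h₁ - complexQuadraticChar F a⁻¹ * h₂

lemma complexQuadraticChar_ne_one (hF : ringChar F ≠ 2) : complexQuadraticChar F ≠ 1 :=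
  (MulChar.ringHomComp_ne_one_iff (RingHom.injective_int (Int.castRingHom ℂ))).mpr
    (quadraticChar_ne_one hF)

lemma complexQuadraticChar_isQuadratic : (complexQuadraticChar F).IsQuadratic :=
  (quadraticChar_isQuadratic F).comp _

variable {ψ : AddChar F ℂ}

lemma sum_complexQuadraticChar_mul_addChar (hF : ringChar F ≠ 2) (t : F) :
    ∑ s, complexQuadraticChar F s * ψ (s * t)
      = complexQuadraticChar F t * gaussSum (complexQuadraticChar F) ψ := by
  by_cases ht : t = 0
  · simp [ht, MulChar.sum_eq_zero_of_ne_one (complexQuadraticChar_ne_one hF)]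
  · have h := gaussSum_mulShift_eq (complexQuadraticChar F) ψ (Units.mk0 t ht)
    rw [complexQuadraticChar_isQuadratic.inv] at h
    simpa [gaussSum, mul_comm t] using h

lemma sum_addChar_mul_sq (hF : ringChar F ≠ 2) (hψ : ψ.IsPrimitive) {a : F} (ha : a ≠ 0) :
    ∑ x, ψ (a * x ^ 2) = complexQuadraticChar F a * gaussSum (complexQuadraticChar F) ψ := by
  rw [← sum_complexQuadraticChar_mul_addChar hF,
    ← Finset.sum_fiberwise univ (fun x : F ↦ x ^ 2)]
  have h (y : F) : ∑ x with x ^ 2 = y, ψ (a * x ^ 2)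
      = complexQuadraticChar F y * ψ (y * a) + ψ (y * a) := by
    have hc : (#{x : F | x ^ 2 = y} : ℂ) = complexQuadraticChar F y + 1 := by
      have := quadraticChar_card_sqrts hF y
      rw [complexQuadraticChar_apply]
      rw [Set.toFinset_ofPred] at this
      exact_mod_cast congrArg (Int.cast : ℤ → ℂ) this
    rw [Finset.sum_congr rfl (g := fun _ ↦ ψ (y * a))
      fun x hx ↦ by rw [(Finset.mem_filter.mp hx).2, mul_comm], Finset.sum_const, nsmul_eq_mul, hc]
    ring
  rw [Finset.sum_congr rfl fun y _ ↦ h y, Finset.sum_add_distrib, AddChar.sum_mulShift a hψ]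
  simp [ha]

lemma sum_addChar_quadratic (hF : ringChar F ≠ 2) (hψ : ψ.IsPrimitive) {a : F} (ha : a ≠ 0)
    (b : F) :
    ∑ x, ψ (a * x ^ 2 + x * b)
      = complexQuadraticChar F a * gaussSum (complexQuadraticChar F) ψ
        * ψ (a⁻¹ * (-b ^ 2 / 4)) := by
  have h2 : (2 : F) ≠ 0 := Ring.two_ne_zero hF
  have h4 : (4 : F) ≠ 0 := by simpa [show (4 : F) = 2 * 2 by norm_num] using h2
  rw [← sum_addChar_mul_sq hF hψ ha, Finset.sum_mul,
    ← Equiv.sum_comp (Equiv.addRight (b / (2 * a))) (fun x ↦ ψ (a * x ^ 2) * ψ (a⁻¹ * (-b ^ 2 / 4)))]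
  refine Finset.sum_congr rfl fun x _ ↦ ?_
  rw [← AddChar.map_add_eq_mul, Equiv.coe_addRight]
  congr 1
  field_simp
  ring

lemma addChar_sum {ι R M : Type*} [AddCommMonoid R] [CommMonoid M] (ψ : AddChar R M)
    (s : Finset ι) (f : ι → R) :
    ψ (∑ i ∈ s, f i) = ∏ i ∈ s, ψ (f i) := by
  classical
  induction s using Finset.induction_on with
  | empty => simp
  | insert i s hi ih => rw [sum_insert hi, prod_insert hi, AddChar.map_add_eq_mul, ih]

variable {d : ℕ}

lemma sum_addChar_normSq_add_dotProduct (hF : ringChar F ≠ 2) (hψ : ψ.IsPrimitive) {a : F}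
    (ha : a ≠ 0) (z : Fin d → F) :
    ∑ m : Fin d → F, ψ (a * normSq m + m ⬝ᵥ z)
      = (complexQuadraticChar F a * gaussSum (complexQuadraticChar F) ψ) ^ d
        * ψ (a⁻¹ * (-normSq z / 4)) := by
  have hz : a⁻¹ * (-normSq z / 4) = ∑ i, a⁻¹ * (-z i ^ 2 / 4) := by
    rw [normSq, ← Finset.mul_sum, ← Finset.sum_div, Finset.sum_neg_distrib]
  have hm (m : Fin d → F) :
      ψ (a * normSq m + m ⬝ᵥ z) = ∏ i, ψ (a * m i ^ 2 + m i * z i) := by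
    rw [← addChar_sum, normSq, dotProduct, Finset.mul_sum, Finset.sum_add_distrib]
  rw [hz, addChar_sum, Finset.sum_congr rfl fun m _ ↦ hm m,
    ← Fintype.prod_sum (fun i x ↦ ψ (a * x ^ 2 + x * z i)),
    Finset.prod_congr rfl fun i _ ↦ sum_addChar_quadratic hF hψ ha (z i),
    Finset.prod_mul_distrib, Finset.prod_const, Finset.card_univ, Fintype.card_fin]

lemma sum_comp_inv {R M : Type*} [Fintype R] [InvolutiveInv R] [AddCommMonoid M] (f : R → M) :
    ∑ s, f s⁻¹ = ∑ s, f s :=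
  Equiv.sum_comp (Equiv.inv R) f

lemma sum_addChar_dotProduct (hψ : ψ.IsPrimitive) (z : Fin d → F) :
    ∑ m : Fin d → F, ψ (m ⬝ᵥ z) = if z = 0 then (Fintype.card F : ℂ) ^ d else 0 := by
  have hm (m : Fin d → F) : ψ (m ⬝ᵥ z) = ∏ i, ψ (m i * z i) := by
    rw [← addChar_sum, dotProduct]
  rw [Finset.sum_congr rfl fun m _ ↦ hm m, ← Fintype.prod_sum (fun i x ↦ ψ (x * z i)),
    Finset.prod_congr rfl fun i _ ↦ AddChar.sum_mulShift (z i) hψ]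
  split_ifs with hz
  · simp [hz]
  · obtain ⟨i, hi⟩ := Function.ne_iff.mp hz
    exact Finset.prod_eq_zero (mem_univ i) (by simpa using hi)

lemma sum_complexQuadraticChar_normSq_mul_addChar (hF : ringChar F ≠ 2) (hψ : ψ.IsPrimitive)
    (n : ℕ) (z : Fin (2 * n + 1) → F) :
    ∑ m : Fin (2 * n + 1) → F, complexQuadraticChar F (normSq m) * ψ (m ⬝ᵥ z)
      = (gaussSum (complexQuadraticChar F) ψ ^ 2) ^ n
        * ((if normSq z = 0 then (Fintype.card F : ℂ) else 0) - 1) := by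
  set G := gaussSum (complexQuadraticChar F) ψ with hG
  have hG0 : G ≠ 0 := gaussSum_ne_zero_of_nontrivial (by simp)
    (complexQuadraticChar_ne_one hF) hψ
  have h4 : (4 : F) ≠ 0 := by
    simpa [show (4 : F) = 2 * 2 by norm_num] using Ring.two_ne_zero hF
  have hs (s : F) :
      ∑ m : Fin (2 * n + 1) → F, complexQuadraticChar F s * ψ (s * normSq m + m ⬝ᵥ z)
        = G ^ (2 * n + 1) * (ψ (s⁻¹ * (-normSq z / 4)) - if s = 0 then 1 else 0) := by
    by_cases h : s = 0
    · simp [h]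
    · rw [← Finset.mul_sum, sum_addChar_normSq_add_dotProduct hF hψ h, ← hG, mul_pow, if_neg h,
        pow_succ (complexQuadraticChar F s), pow_mul, complexQuadraticChar_sq h]
      linear_combination G ^ (2 * n + 1) * ψ (s⁻¹ * (-normSq z / 4)) * complexQuadraticChar_sq h
  have key : (∑ m : Fin (2 * n + 1) → F, complexQuadraticChar F (normSq m) * ψ (m ⬝ᵥ z)) * G
      = G ^ (2 * n + 1) * ((if normSq z = 0 then (Fintype.card F : ℂ) else 0) - 1) := by
    calc
      _ = ∑ m : Fin (2 * n + 1) → F, ∑ s,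
          complexQuadraticChar F s * ψ (s * normSq m + m ⬝ᵥ z) := by
        rw [Finset.sum_mul]
        refine Finset.sum_congr rfl fun m _ ↦ ?_
        rw [mul_right_comm, ← sum_complexQuadraticChar_mul_addChar hF, Finset.sum_mul]
        simp only [AddChar.map_add_eq_mul, mul_assoc]
      _ = _ := by
        rw [Finset.sum_comm, Finset.sum_congr rfl fun s _ ↦ hs s, ← Finset.mul_sum,
          Finset.sum_sub_distrib,
          sum_comp_inv (fun s ↦ ψ (s * (-normSq z / 4))),
          AddChar.sum_mulShift _ hψ]
        simp [h4]
  apply mul_right_cancel₀ hG0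
  rw [key]
  ring

lemma sum_normSq_eq_zero_mul_addChar (hF : ringChar F ≠ 2) (hψ : ψ.IsPrimitive)
    (n : ℕ) (z : Fin (2 * n + 1) → F) :
    ∑ m : Fin (2 * n + 1) → F, (if normSq m = 0 then (Fintype.card F : ℂ) else 0) * ψ (m ⬝ᵥ z)
      = (if z = 0 then (Fintype.card F : ℂ) ^ (2 * n + 1) else 0)
        + (gaussSum (complexQuadraticChar F) ψ ^ 2) ^ (n + 1)
          * complexQuadraticChar F (-normSq z) := by
  set G := gaussSum (complexQuadraticChar F) ψ with hG
  have h4 : complexQuadraticChar F (-normSq z / 4) = complexQuadraticChar F (-normSq z) := by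
    rw [div_eq_mul_inv, map_mul, complexQuadraticChar_inv, show (4 : F) = 2 ^ 2 by norm_num,
      map_pow, complexQuadraticChar_sq (Ring.two_ne_zero hF), mul_one]
  have hs (s : F) : ∑ m : Fin (2 * n + 1) → F, ψ (s * normSq m + m ⬝ᵥ z)
      = (if s = 0 then (if z = 0 then (Fintype.card F : ℂ) ^ (2 * n + 1) else 0) else 0)
        + G ^ (2 * n + 1) * (complexQuadraticChar F s⁻¹ * ψ (s⁻¹ * (-normSq z / 4))) := by
    by_cases h : s = 0
    · simp [h, sum_addChar_dotProduct hψ]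
    · rw [sum_addChar_normSq_add_dotProduct hF hψ h, ← hG, mul_pow, if_neg h,
        pow_succ (complexQuadraticChar F s), pow_mul, complexQuadraticChar_sq h,
        complexQuadraticChar_inv]
      ring
  calc
    _ = ∑ m : Fin (2 * n + 1) → F, ∑ s, ψ (s * normSq m + m ⬝ᵥ z) := by
      refine Finset.sum_congr rfl fun m _ ↦ ?_
      simp only [AddChar.map_add_eq_mul]
      rw [← Finset.sum_mul, AddChar.sum_mulShift _ hψ]
      simp
    _ = _ := by
      rw [Finset.sum_comm, Finset.sum_congr rfl fun s _ ↦ hs s, Finset.sum_add_distrib,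
        ← Finset.mul_sum,
        sum_comp_inv
          (fun s ↦ complexQuadraticChar F s * ψ (s * (-normSq z / 4))),
        sum_complexQuadraticChar_mul_addChar hF, h4]
      simp only [Finset.sum_ite_eq', mem_univ, if_true]
      ring

/-- The Fourier transform of the nonnegative weight `q · 1_{‖m‖ = 0} + 1 + η(‖m‖)`. -/
lemma sum_weight_mul_addChar (hF : Fintype.card F % 4 = 3) (hψ : ψ.IsPrimitive) {n : ℕ}
    (hn : Odd n) (z : Fin (2 * n + 1) → F) :
    ∑ m : Fin (2 * n + 1) → F, ((if normSq m = 0 then (Fintype.card F : ℂ) else 0) + 1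
        + complexQuadraticChar F (normSq m)) * ψ (m ⬝ᵥ z)
      = (if z = 0 then 2 * (Fintype.card F : ℂ) ^ (2 * n + 1) else 0)
        - (Fintype.card F : ℂ) ^ (n + 1)
          * ((if normSq z = 0 then 1 else 0) + complexQuadraticChar F (normSq z))
        + (Fintype.card F : ℂ) ^ n := by
  have hF2 : ringChar F ≠ 2 := fun h ↦ by
    have := FiniteField.even_card_of_char_two h
    lia
  have hneg : complexQuadraticChar F (-1) = -1 := by
    rw [complexQuadraticChar_apply, quadraticChar_neg_one_iff_not_isSquare.mpr]
    · simp
    · rw [FiniteField.isSquare_neg_one_iff]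
      simpa using hF
  have hG : gaussSum (complexQuadraticChar F) ψ ^ 2 = -(Fintype.card F : ℂ) := by
    rw [gaussSum_sq (complexQuadraticChar_ne_one hF2) complexQuadraticChar_isQuadratic hψ, hneg,
      neg_one_mul]
  have h₁ := sum_complexQuadraticChar_normSq_mul_addChar hF2 hψ n z
  have h₂ := sum_normSq_eq_zero_mul_addChar hF2 hψ n z
  rw [hG, hn.neg_pow] at h₁
  rw [hG, (hn.add_one).neg_pow, ← neg_one_mul, map_mul, hneg] at h₂
  simp only [add_mul, Finset.sum_add_distrib, one_mul]
  rw [h₁, h₂, sum_addChar_dotProduct hψ]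
  split_ifs <;> ring

lemma sum_sum_addChar_dotProduct_sub {R : Type*} [CommRing R] [Finite R] (ψ : AddChar R ℂ)
    (A : Finset (Fin d → R)) (m : Fin d → R) :
    ∑ x ∈ A, ∑ y ∈ A, ψ (m ⬝ᵥ (x - y)) = ((‖∑ x ∈ A, ψ (m ⬝ᵥ x)‖ ^ 2 : ℝ) : ℂ) := by
  push_cast
  rw [← Complex.mul_conj', map_sum, Finset.sum_mul_sum]
  refine Finset.sum_congr rfl fun x _ ↦ Finset.sum_congr rfl fun y _ ↦ ?_
  rw [dotProduct_sub, sub_eq_add_neg, AddChar.map_add_eq_mul, AddChar.map_neg_eq_conj]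

lemma weight_nonneg (t : F) :
    (0 : ℝ) ≤ (if t = 0 then (Fintype.card F : ℝ) else 0) + 1 + (quadraticChar F t : ℤ) := by
  have h : (-1 : ℤ) ≤ quadraticChar F t := by
    rcases quadraticChar_isQuadratic F t with h | h | h <;> rw [h] <;> norm_num
  have h' : (-1 : ℝ) ≤ (quadraticChar F t : ℤ) := by exact_mod_cast h
  split_ifs
  · have : (0 : ℝ) ≤ Fintype.card F := Nat.cast_nonneg _
    linarith
  · linarith

lemma two_mul_SQpairs_add_ZRpairs (A : Finset (Fin d → F)) :
    2 * ((SQpairs A : ℝ) + ZRpairs A) = (#A : ℝ) ^ 2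
      + ∑ x ∈ A, ∑ y ∈ A, ((if normSq (x - y) = 0 then (1 : ℝ) else 0)
        + (quadraticChar F (normSq (x - y)) : ℤ)) := by
  have h (t : F) : 2 * ((if quadraticChar F t = 1 then (1 : ℝ) else 0) + if t = 0 then 1 else 0)
      = 1 + ((if t = 0 then 1 else 0) + (quadraticChar F t : ℤ)) := by
    by_cases ht : t = 0
    · norm_num [ht]
    · rcases quadraticChar_dichotomy ht with h | h <;> norm_num [h, ht]
  rw [SQpairs, ZRpairs, Finset.card_filter, Finset.card_filter]
  push_cast
  rw [← Finset.sum_add_distrib, Finset.mul_sum, Finset.sum_congr rfl fun p _ ↦ h _,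
    Finset.sum_product]
  simp only [Finset.sum_add_distrib, Finset.sum_const, nsmul_eq_mul, mul_one]
  ring

lemma sum_weight_mul_norm_sq (hF : Fintype.card F % 4 = 3) (hψ : ψ.IsPrimitive) {n : ℕ}
    (hn : Odd n) (A : Finset (Fin (2 * n + 1) → F)) :
    ∑ m : Fin (2 * n + 1) → F, ((if normSq m = 0 then (Fintype.card F : ℝ) else 0) + 1
        + (quadraticChar F (normSq m) : ℤ)) * ‖∑ x ∈ A, ψ (m ⬝ᵥ x)‖ ^ 2
      = 2 * (Fintype.card F : ℝ) ^ (2 * n + 1) * #A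
        - (Fintype.card F : ℝ) ^ (n + 1) * ∑ x ∈ A, ∑ y ∈ A,
          ((if normSq (x - y) = 0 then (1 : ℝ) else 0)
            + (quadraticChar F (normSq (x - y)) : ℤ))
        + (Fintype.card F : ℝ) ^ n * (#A : ℝ) ^ 2 := by
  apply Complex.ofReal_injective
  calc
    _ = ∑ m : Fin (2 * n + 1) → F, ∑ x ∈ A, ∑ y ∈ A,
        ((if normSq m = 0 then (Fintype.card F : ℂ) else 0) + 1
          + complexQuadraticChar F (normSq m)) * ψ (m ⬝ᵥ (x - y)) := by
      rw [Complex.ofReal_sum]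
      refine Finset.sum_congr rfl fun m _ ↦ ?_
      simp only [← Finset.mul_sum]
      rw [sum_sum_addChar_dotProduct_sub, Complex.ofReal_mul, complexQuadraticChar_apply]
      congr 1
      split_ifs <;> push_cast <;> rfl
    _ = ∑ x ∈ A, ∑ y ∈ A, ∑ m : Fin (2 * n + 1) → F,
        ((if normSq m = 0 then (Fintype.card F : ℂ) else 0) + 1
          + complexQuadraticChar F (normSq m)) * ψ (m ⬝ᵥ (x - y)) := by
      rw [Finset.sum_comm]
      exact Finset.sum_congr rfl fun x _ ↦ Finset.sum_comm
    _ = _ := by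
      simp_rw [sum_weight_mul_addChar hF hψ hn, sub_eq_zero, complexQuadraticChar_apply]
      push_cast
      simp_rw [apply_ite Complex.ofReal, Complex.ofReal_one, Complex.ofReal_zero]
      simp only [Finset.sum_add_distrib, Finset.sum_sub_distrib, mul_add, Finset.mul_sum,
        Finset.sum_ite_eq, Finset.sum_const, nsmul_eq_mul, Finset.sum_ite_mem,
        Finset.inter_self]
      ring

end QuadraticGaussSums

theorem distance_structure_d3q3 (q d : ℕ) (F : Type) [Field F] [Fintype F] [DecidableEq F]
    (hcard : Fintype.card F = q) (hodd : Odd q)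
    (hd : d % 4 = 3) (hq : q % 4 = 3) (hd3 : 3 ≤ d)
    (A : Finset (Fin d → F)) :
    (SQpairs A : ℝ) + (ZRpairs A : ℝ) ≤ (A.card : ℝ) ^ 2 / 2 + (A.card : ℝ) ^ 2 / (2 * q)
      - (A.card : ℝ) ^ 2 / (2 * (q : ℝ) ^ ((d - 1) / 2)) - (A.card : ℝ) ^ 2 / (2 * (q : ℝ) ^ ((d + 1) / 2))
      + (q : ℝ) ^ ((d - 1) / 2) * (A.card : ℝ) := by
  obtain ⟨n, rfl, hn⟩ : ∃ n, d = 2 * n + 1 ∧ Odd n :=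
    ⟨(d - 1) / 2, by lia, Nat.odd_iff.mpr (by lia)⟩
  have e₁ : (2 * n + 1 - 1) / 2 = n := by lia
  have e₂ : (2 * n + 1 + 1) / 2 = n + 1 := by lia
  rw [e₁, e₂]
  subst hcard
  have hψ := AddChar.FiniteField.primitiveChar_to_Complex_isPrimitive F
  set ψ := AddChar.FiniteField.primitiveChar_to_Complex F
  have hsum := sum_weight_mul_norm_sq hq hψ hn A
  have hzero := Finset.single_le_sum (s := univ)
    (f := fun m : Fin (2 * n + 1) → F ↦ ((if normSq m = 0 then (Fintype.card F : ℝ) else 0) + 1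
        + (quadraticChar F (normSq m) : ℤ)) * ‖∑ x ∈ A, ψ (m ⬝ᵥ x)‖ ^ 2)
    (fun m _ ↦ mul_nonneg (weight_nonneg _) (sq_nonneg _)) (mem_univ 0)
  rw [hsum] at hzero
  have hnorm : normSq (0 : Fin (2 * n + 1) → F) = 0 := by simp [normSq]
  simp only [hnorm, if_true, zero_dotProduct, AddChar.map_zero_eq_one, Finset.sum_const,
    nsmul_eq_mul, mul_one, Complex.norm_natCast, quadraticChar_zero, Int.cast_zero,
    add_zero] at hzero
  have hcount := two_mul_SQpairs_add_ZRpairs A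
  set S := ∑ x ∈ A, ∑ y ∈ A, ((if normSq (x - y) = 0 then (1 : ℝ) else 0)
    + (quadraticChar F (normSq (x - y)) : ℤ))
  have hq0 : (0 : ℝ) < Fintype.card F := by exact_mod_cast Fintype.card_pos
  set Q : ℝ := (Fintype.card F : ℝ)
  have hS : S ≤ (2 * Q ^ (2 * n + 1) * #A + Q ^ n * (#A : ℝ) ^ 2 - (Q + 1) * (#A : ℝ) ^ 2)
      / Q ^ (n + 1) := by
    rw [le_div_iff₀ (by positivity)]
    linarith
  have hdiv : (2 * Q ^ (2 * n + 1) * #A + Q ^ n * (#A : ℝ) ^ 2 - (Q + 1) * (#A : ℝ) ^ 2)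
      / Q ^ (n + 1) = 2 * ((#A : ℝ) ^ 2 / (2 * Q) - (#A : ℝ) ^ 2 / (2 * Q ^ n)
        - (#A : ℝ) ^ 2 / (2 * Q ^ (n + 1)) + Q ^ n * #A) := by
    field_simp
    ring
  rw [hdiv] at hS
  linarith
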